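/- Let 𝔤 be a finite-dimensional Lie algebra over k, V a finite-dimensional representation of 𝔤, and 𝔥 an ideal of 𝔤 of codimension one with 𝔤 = 𝔥 + k·s, where the element s acts semisimply (diagonalizably) both on V and, via the adjoint action, on 𝔥. Then (SV)^𝔥_si = (SV)^𝔤_si. -/

import Mathlib

open Module MvPolynomial

namespace Paper

variable (k : Type) [Field k]

/-- The stabilizer `𝔤_x` of `x ∈ 𝔤*`. -/
def stab (L : Type) [LieRing L] [LieAlgebra k L] (x : Module.Dual k L) : Submodule k L where
  carrier := {v | ∀ w, x ⁅v, w⁆ = 0}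
  add_mem' := by intro a b ha hb w; simp [add_lie, ha w, hb w]
  zero_mem' := by intro w; simp
  smul_mem' := by intro c a ha w; simp [smul_lie, ha w]

/-- The index `i(𝔤)` of a Lie algebra: the minimal dimension of a stabilizer. -/
noncomputable def lieIndex (L : Type) [LieRing L] [LieAlgebra k L] : ℕ :=
  ⨅ x : Module.Dual k L, finrank k (stab k L x)

/-- The set of non-regular elements `𝔤* \ 𝔤*_reg`. -/
def nonReg (L : Type) [LieRing L] [LieAlgebra k L] : Set (Module.Dual k L) :=
  {x | finrank k (stab k L x) ≠ lieIndex k L}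

variable {k}
variable {L : Type} [LieRing L] [LieAlgebra k L]

/-- The element of the polynomial model of the symmetric algebra `S(V)`
(w.r.t. the basis `bV`) corresponding to a vector `v ∈ V`. -/
noncomputable def rep {ι V : Type} [Fintype ι] [AddCommGroup V] [Module k V]
    (bV : Basis ι k V) (v : V) : MvPolynomial ι k :=
  ∑ i, MvPolynomial.C (bV.repr v i) * MvPolynomial.X i

/-- The action of `v ∈ 𝔤` on the symmetric algebra `S(V)` of a `𝔤`-module `V`,
as a derivation (extending `w ↦ v · w = ⁅v, w⁆`). -/
noncomputable def actDer {ι V : Type} [Fintype ι] [AddCommGroup V] [Module k V]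
    [LieRingModule L V] (bV : Basis ι k V) (v : L) :
    Derivation k (MvPolynomial ι k) (MvPolynomial ι k) :=
  MvPolynomial.mkDerivation k fun i => rep bV ⁅v, bV i⁆

/-- Semi-invariants in `S(V)` for the action of a (sub)space `A` mapping to `𝔤` via `em`:
nonzero `f` with `a · f = χ(a) • f` for some weight `χ ∈ A*`. -/
noncomputable def semiInvSet {ι V A : Type} [Fintype ι] [AddCommGroup V] [Module k V]
    [LieRingModule L V] [AddCommGroup A] [Module k A]
    (bV : Basis ι k V) (em : A → L) : Set (MvPolynomial ι k) :=
  {f | f ≠ 0 ∧ ∃ χ : Module.Dual k A, ∀ a : A, actDer bV (em a) f = χ a • f}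

/-- The semi-center: the subalgebra generated by all semi-invariants. -/
noncomputable def semiCenter {ι V A : Type} [Fintype ι] [AddCommGroup V] [Module k V]
    [LieRingModule L V] [AddCommGroup A] [Module k A]
    (bV : Basis ι k V) (em : A → L) : Subalgebra k (MvPolynomial ι k) :=
  Algebra.adjoin k (semiInvSet bV em)

/-- The subalgebra of invariants in `S(V)`. -/
noncomputable def invariants {ι V A : Type} [Fintype ι] [AddCommGroup V] [Module k V]
    [LieRingModule L V] (bV : Basis ι k V) (em : A → L) : Subalgebra k (MvPolynomial ι k) where
  carrier := {f | ∀ a : A, actDer bV (em a) f = 0}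
  mul_mem' := by intro f g hf hg a; simp [Derivation.leibniz, hf a, hg a]
  one_mem' := by intro a; simp
  add_mem' := by intro f g hf hg a; simp [hf a, hg a]
  zero_mem' := by intro a; simp
  algebraMap_mem' := by intro c a; simp

/-- The structure matrix `B = ([v_i, v_j])_{ij}` of `𝔤` w.r.t. a basis. -/
noncomputable def structMat {ι : Type} [Fintype ι] (b : Basis ι k L) :
    Matrix ι ι (MvPolynomial ι k) :=
  Matrix.of fun i j => rep b ⁅b i, b j⁆

/-- The set of `s × s` minors of the structure matrix. -/
noncomputable def minorsSet {ι : Type} [Fintype ι] [DecidableEq ι] (b : Basis ι k L) (s : ℕ) :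
    Set (MvPolynomial ι k) :=
  {p | ∃ f g : Fin s ↪ ι, p = ((structMat b).submatrix f g).det}

/-- `g` is a greatest common divisor of the set `A`. -/
def IsGcdOf {α : Type} [CommMonoidWithZero α] (g : α) (A : Set α) : Prop :=
  (∀ a ∈ A, g ∣ a) ∧ ∀ c, (∀ a ∈ A, c ∣ a) → c ∣ g

/-- The Pfaffian of an `n × n` matrix (`n = 2m` even), via the standard formula
`pf(A) = (2^m m!)⁻¹ Σ_σ sgn(σ) Π_i A_{σ(2i) σ(2i+1)}` (valid in characteristic zero). -/
noncomputable def pfaffian {n : ℕ} {R : Type} [CommRing R] [Algebra ℚ R]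
    (A : Matrix (Fin n) (Fin n) R) : R :=
  ((2 ^ (n / 2) * (n / 2).factorial : ℚ)⁻¹) •
    ∑ σ : Equiv.Perm (Fin n), (Equiv.Perm.sign σ : ℤ) •
      ∏ i : Fin (n / 2),
        A (σ ⟨2 * i.1, by have := i.2; omega⟩) (σ ⟨2 * i.1 + 1, by have := i.2; omega⟩)

/-- The set of Pfaffians of the principal `s × s` minors of the structure matrix. -/
noncomputable def principalPfaffians {ι : Type} [Fintype ι] [DecidableEq ι] [CharZero k]
    (b : Basis ι k L) (s : ℕ) : Set (MvPolynomial ι k) :=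
  {p | ∃ f : Fin s ↪ ι, p = pfaffian ((structMat b).submatrix f f)}

/-- Evaluation of a polynomial in `S𝔤` at a point `x ∈ 𝔤*`. -/
noncomputable def evalAt {ι : Type} [Fintype ι] (b : Basis ι k L) (x : Module.Dual k L) :
    MvPolynomial ι k →ₐ[k] k :=
  MvPolynomial.aeval fun i => x (b i)

/-- The vanishing ideal of a subset `Z ⊆ 𝔤*`. -/
noncomputable def vanIdeal {ι : Type} [Fintype ι] (b : Basis ι k L)
    (Z : Set (Module.Dual k L)) : Ideal (MvPolynomial ι k) where
  carrier := {f | ∀ x ∈ Z, evalAt b x f = 0}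
  add_mem' := by intro f g hf hg x hx; simp [map_add, hf x hx, hg x hx]
  zero_mem' := by intro x hx; simp
  smul_mem' := by intro c f hf x hx; simp [smul_eq_mul, map_mul, hf x hx]

/-- The dimension (Krull dimension of the coordinate ring) of the Zariski closure of
a subset `Z ⊆ 𝔤*`. -/
noncomputable def closedDim {ι : Type} [Fintype ι] (b : Basis ι k L)
    (Z : Set (Module.Dual k L)) : WithBot (WithTop ℕ) :=
  ringKrullDim (MvPolynomial ι k ⧸ vanIdeal b Z)

/-- The rank `r_𝔞(V)` of the structure matrix of the `𝔤`-module `V` with respect to a family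
`vs` spanning the acting subalgebra `𝔞`, computed over the fraction field of `S(V)`. -/
noncomputable def rkFam {ι V κ : Type} [Fintype ι] [DecidableEq ι] [Fintype κ]
    [AddCommGroup V] [Module k V] [LieRingModule L V]
    (bV : Basis ι k V) (vs : κ → L) : ℕ :=
  Matrix.rank ((Matrix.of fun (j : ι) (i : κ) => rep bV ⁅vs i, bV j⁆).map
    (algebraMap (MvPolynomial ι k) (FractionRing (MvPolynomial ι k))))

/-- The map `ρ : A ⊗_k 𝔤 → Der_k(A)` induced by an action of `𝔤` (given on a basis `bG`)
by derivations on a commutative `k`-algebra `A`; `ρ(a ⊗ v) = a • D(v)`. -/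
noncomputable def rhoMap {A G κ : Type} [CommRing A] [Algebra k A]
    [AddCommGroup G] [Module k G]
    (bG : Basis κ k G) (D : G → Derivation k A A) :
    TensorProduct k A G →ₗ[A] (A →ₗ[k] A) :=
  (Basis.baseChange A bG).constr k fun i => (D (bG i)).toLinearMap

/-- The invariant subfield `F^𝔤` for an action of `𝔤` by derivations on a field `F ⊇ k`. -/
noncomputable def invField {F G : Type} [Field F] [Algebra k F]
    (D : G → Derivation k F F) : IntermediateField k F where
  carrier := {x | ∀ v : G, D v x = 0}
  mul_mem' := by intro a b ha hb v; simp [Derivation.leibniz, ha v, hb v]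
  one_mem' := by intro v; simp
  add_mem' := by intro a b ha hb v; simp [ha v, hb v]
  zero_mem' := by intro v; simp
  algebraMap_mem' := by intro c v; simp
  inv_mem' := by
    intro x hx v
    rcases eq_or_ne x 0 with h | h
    · simp [h]
    · have h1 : D v (x * x⁻¹) = 0 := by
        rw [mul_inv_cancel₀ h]; simp
      rw [Derivation.leibniz] at h1
      have h2 : x • D v x⁻¹ = 0 := by
        rw [hx v] at h1; simpa using h1
      rcases smul_eq_zero.1 h2 with h3 | h3
      · exact absurd h3 h
      · exact h3

/-- The action of `𝔤` on a field `F` by derivations is *geometric* if the natural map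
`F ⊗_{F^𝔤} 𝔤 → Der_{F^𝔤}(F)` is surjective, i.e. every `k`-derivation of `F` vanishing
on the invariant subfield `F^𝔤` lies in the `F`-span of the derivations coming from `𝔤`. -/
def IsGeometric {F G : Type} [Field F] [Algebra k F]
    (D : G → Derivation k F F) : Prop :=
  ∀ E : Derivation k F F, (∀ x : F, (∀ v : G, D v x = 0) → E x = 0) →
    E.toLinearMap ∈ Submodule.span F (Set.range fun v : G => (D v).toLinearMap)


/-- The subalgebra of invariants for an action of `G` by derivations on a
commutative `k`-algebra `A`. -/
noncomputable def invariantsOf {A G : Type} [CommRing A] [Algebra k A]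
    (D : G → Derivation k A A) : Subalgebra k A where
  carrier := {f | ∀ v : G, D v f = 0}
  mul_mem' := by intro f g hf hg v; simp [Derivation.leibniz, hf v, hg v]
  one_mem' := by intro v; simp
  add_mem' := by intro f g hf hg v; simp [hf v, hg v]
  zero_mem' := by intro v; simp
  algebraMap_mem' := by intro c v; simp

/-- The map `ρ* : S(V) ⊗ V → S(V) ⊗ 𝔤*` dual to the action map, determined by
`ρ*(1 ⊗ w)(v) = v · w`. -/
noncomputable def rhoStar {ι ιV V : Type} [Fintype ι] [Fintype ιV]
    [AddCommGroup V] [Module k V] [LieRingModule L V]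
    (b : Basis ι k L) (bV : Basis ιV k V) :
    TensorProduct k (MvPolynomial ιV k) V →ₗ[MvPolynomial ιV k]
      TensorProduct k (MvPolynomial ιV k) (Module.Dual k L) :=
  (Basis.baseChange (MvPolynomial ιV k) bV).constr k fun j =>
    ∑ i, (rep bV ⁅b i, bV j⁆) ⊗ₜ[k] (b.coord i)

/-- A bundled finite-dimensional Lie algebra over `k` together with a finite basis
(providing a polynomial model of its symmetric algebra). -/
structure FDLieModel (k : Type) [Field k] where
  carrier : Type
  [lieRing : LieRing carrier]
  [lieAlg : LieAlgebra k carrier]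
  ind : Type
  [fin : Fintype ind]
  [deceq : DecidableEq ind]
  basis : Basis ind k carrier

attribute [instance] FDLieModel.lieRing FDLieModel.lieAlg FDLieModel.fin FDLieModel.deceq


section SemiCenterExtension

variable {ι V : Type} [Fintype ι] [AddCommGroup V] [Module k V]

theorem rep_basis (bV : Basis ι k V) (i : ι) : rep bV (bV i) = X i := by
  classical
  simp [rep, Finsupp.single_apply]

/-- `rep` as a linear map. -/
noncomputable def repLin (bV : Basis ι k V) : V →ₗ[k] MvPolynomial ι k where
  toFun := rep bV
  map_add' v w := by simp [rep, add_mul, Finset.sum_add_distrib]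
  map_smul' c v := by simp [rep, Finset.smul_sum, MvPolynomial.smul_eq_C_mul, mul_assoc]

variable [LieRingModule L V] [LieModule k L V]

theorem actDer_rep (bV : Basis ι k V) (v : L) (w : V) :
    actDer bV v (rep bV w) = rep bV ⁅v, w⁆ := by
  have h : (actDer bV v).toLinearMap ∘ₗ repLin bV =
      repLin bV ∘ₗ (LieModule.toEnd k L V v) := by
    refine bV.ext fun i => ?_
    change actDer bV v (rep bV (bV i)) = rep bV ⁅v, bV i⁆
    rw [rep_basis, actDer, mkDerivation_X]
  exact LinearMap.congr_fun h w

/-- The action `actDer` as a linear map in the acting Lie algebra element. -/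
noncomputable def actDerLin (bV : Basis ι k V) :
    L →ₗ[k] Derivation k (MvPolynomial ι k) (MvPolynomial ι k) where
  toFun := actDer bV
  map_add' v w := by
    refine MvPolynomial.derivation_ext fun i => ?_
    simp only [actDer, mkDerivation_X, Derivation.add_apply, add_lie]
    exact (repLin bV).map_add _ _
  map_smul' c v := by
    refine MvPolynomial.derivation_ext fun i => ?_
    simp only [actDer, mkDerivation_X, Derivation.smul_apply, smul_lie, RingHom.id_apply]
    exact (repLin bV).map_smul _ _

theorem actDer_lie (bV : Basis ι k V) (v w : L) :
    actDer bV ⁅v, w⁆ = ⁅actDer bV v, actDer bV w⁆ := by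
  refine MvPolynomial.derivation_ext fun i => ?_
  rw [Derivation.commutator_apply, ← rep_basis bV, actDer_rep, actDer_rep, actDer_rep,
    actDer_rep, actDer_rep, lie_lie]
  exact (repLin bV).map_sub _ _

/-- The eigenvectors of a derivation span the whole polynomial ring as soon as the variables
lie in their span. -/
theorem iSup_eigenspace_derivation_eq_top {σ : Type}
    (D : Derivation k (MvPolynomial σ k) (MvPolynomial σ k))
    (hX : ∀ i, X i ∈ ⨆ μ : k, Module.End.eigenspace D.toLinearMap μ) :
    ⨆ μ : k, Module.End.eigenspace D.toLinearMap μ = ⊤ := by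
  let E : Submonoid (MvPolynomial σ k) :=
    { carrier := {f | ∃ μ : k, D f = μ • f}
      one_mem' := ⟨0, by simp⟩
      mul_mem' := by
        rintro f g ⟨a, ha⟩ ⟨b, hb⟩
        refine ⟨a + b, ?_⟩
        rw [D.leibniz, ha, hb, smul_eq_mul, smul_eq_mul, mul_smul_comm, mul_smul_comm,
          mul_comm g f, add_smul, add_comm] }
  have hle : ⨆ μ : k, Module.End.eigenspace D.toLinearMap μ ≤
      Subalgebra.toSubmodule (Algebra.adjoin k (E : Set (MvPolynomial σ k))) :=
    iSup_le fun μ f hf => Algebra.subset_adjoin ⟨μ, Module.End.mem_eigenspace_iff.1 hf⟩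
  have htop : Algebra.adjoin k (E : Set (MvPolynomial σ k)) = ⊤ := by
    rw [eq_top_iff, ← MvPolynomial.adjoin_range_X, Algebra.adjoin_le_iff]
    rintro _ ⟨i, rfl⟩
    exact hle (hX i)
  rw [eq_top_iff, ← Algebra.top_toSubmodule, ← htop, Algebra.adjoin_eq_span,
    Submonoid.closure_eq, Submodule.span_le]
  rintro f ⟨μ, hμ⟩
  exact Submodule.mem_iSup_of_mem μ (Module.End.mem_eigenspace_iff.2 hμ)

theorem iSup_eigenspace_actDer_eq_top (bV : Basis ι k V) {s : L} {κ : Type} (B : Basis κ k V)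
    (hB : ∀ i, ∃ μ : k, ⁅s, B i⁆ = μ • B i) :
    ⨆ μ : k, Module.End.eigenspace (actDer bV s).toLinearMap μ = ⊤ := by
  refine iSup_eigenspace_derivation_eq_top _ fun i => ?_
  have hle : ⊤ ≤ (⨆ μ : k, Module.End.eigenspace (actDer bV s).toLinearMap μ).comap
      (repLin bV) := by
    rw [← B.span_eq, Submodule.span_le]
    rintro _ ⟨j, rfl⟩
    obtain ⟨μ, hμ⟩ := hB j
    refine Submodule.mem_iSup_of_mem μ (Module.End.mem_eigenspace_iff.2 ?_)
    change actDer bV s (rep bV (B j)) = μ • repLin bV (B j)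
    rw [actDer_rep, hμ]
    exact (repLin bV).map_smul _ _
  rw [← rep_basis bV]
  exact hle (Submodule.mem_top (x := bV i))

theorem mem_semiInvSet_id_of_forall_exists (bV : Basis ι k V) {f : MvPolynomial ι k} (hf : f ≠ 0)
    (h : ∀ v : L, ∃ c : k, actDer bV v f = c • f) : f ∈ semiInvSet bV (id : L → L) := by
  obtain ⟨m, hm⟩ := MvPolynomial.ne_zero_iff.1 hf
  let χ : Module.Dual k L :=
    { toFun := fun v => coeff m (actDerLin bV v f) / coeff m f
      map_add' := fun v w => by simp [add_div]
      map_smul' := fun c v => by simp [mul_div_assoc] }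
  refine ⟨hf, χ, fun v => ?_⟩
  obtain ⟨c, hc⟩ := h v
  have hχ : χ v = c := by
    change coeff m (actDer bV v f) / coeff m f = c
    rw [hc, coeff_smul, smul_eq_mul, mul_div_cancel_right₀ _ hm]
  rw [hχ, id, hc]

/-- If `T` shifts `S`-weights by `μ`, then the `S`-components of a `T`-eigenvector are again
`T`-eigenvectors for the same eigenvalue (which vanishes when `μ ≠ 0`, because only finitely many
components are nonzero). -/
theorem apply_component_eq_smul [CharZero k] {M : Type} [AddCommGroup M] [Module k M]
    {S T : Module.End k M} {μ c : k} (hST : ∀ m, S (T m) = T (S m) + μ • T m) {g : k →₀ M}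
    (hg : ∀ a, g a ∈ S.eigenspace a)
    (hT : T (g.sum fun _ m => m) = c • g.sum fun _ m => m) (a : k) : T (g a) = c • g a := by
  classical
  have hshift : ∀ b, T (g (b - μ)) = c • g b := by
    let t : Finset k := g.support ∪ g.support.map (Equiv.addRight μ).toEmbedding
    have hsum : ∑ b ∈ t, T (g (b - μ)) = ∑ b ∈ t, c • g b := by
      have h₁ : ∑ b ∈ t, T (g (b - μ)) = T (g.sum fun _ m => m) := by
        rw [Finsupp.sum, map_sum, ← Finset.sum_subset
          (Finset.subset_union_right : g.support.map (Equiv.addRight μ).toEmbedding ⊆ t)]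
        · simp
        · intro b _ hb
          have : g (b - μ) = 0 := by
            by_contra h
            exact hb (Finset.mem_map.2 ⟨b - μ, Finsupp.mem_support_iff.2 h, by simp⟩)
          rw [this, map_zero]
      have h₂ : ∑ b ∈ t, c • g b = c • g.sum fun _ m => m := by
        rw [Finsupp.sum, Finset.smul_sum]
        refine (Finset.sum_subset Finset.subset_union_left fun b _ hb => ?_).symm
        rw [Finsupp.notMem_support_iff.1 hb, smul_zero]
      rw [h₁, h₂, hT]
    have hv : ∀ b, T (g (b - μ)) ∈ S.eigenspace b := fun b => by
      rw [Module.End.mem_eigenspace_iff, hST, Module.End.mem_eigenspace_iff.1 (hg _), map_smul,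
        ← add_smul, sub_add_cancel]
    have huniq := (iSupIndep_iff_finsetSum_eq_imp_eq _).1 S.eigenspaces_iSupIndep t
      (fun b => T (g (b - μ))) (fun b => c • g b)
      (fun b _ => ⟨hv b, Submodule.smul_mem _ _ (hg b)⟩) hsum
    intro b
    by_cases hb : b ∈ t
    · exact huniq b hb
    · have h₁ : g b = 0 := by
        by_contra h
        exact hb (Finset.mem_union_left _ (Finsupp.mem_support_iff.2 h))
      have h₂ : g (b - μ) = 0 := by
        by_contra h
        exact hb (Finset.mem_union_right _
          (Finset.mem_map.2 ⟨b - μ, Finsupp.mem_support_iff.2 h, by simp⟩))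
      rw [h₁, h₂, map_zero, smul_zero]
  rcases eq_or_ne μ 0 with rfl | hμ
  · simpa using hshift a
  have hcg : ∀ b, c • g b = 0 := by
    intro b
    by_contra hb
    have hne : ∀ n : ℕ, c • g (b - n * μ) ≠ 0 := by
      intro n
      induction n with
      | zero => simpa using hb
      | succ n ih =>
        intro h
        refine ih ?_
        rw [← hshift, sub_sub, ← add_one_mul, ← Nat.cast_succ]
        rcases smul_eq_zero.1 h with h | h
        · exact absurd (by rw [h, zero_smul]) hb
        · rw [h, map_zero]
    refine Set.infinite_of_injective_forall_mem (f := fun n : ℕ => b - n * μ) ?_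
      (fun n => ?_) g.support.finite_toSet
    · intro m n hmn
      simpa [hμ] using hmn
    · exact Finsupp.mem_support_iff.2 fun h => hne n (by rw [h, smul_zero])
  have := hshift (a + μ)
  rw [add_sub_cancel_right] at this
  rw [this, hcg, hcg]

end SemiCenterExtension

/-- If `𝔥` is a codimension-one ideal of `𝔤` with `𝔤 = 𝔥 + k·s`,
where `s` acts diagonalizably on `V` and (via the adjoint action) on `𝔥`, then
`(SV)^𝔥_si = (SV)^𝔤_si`. -/
theorem statement12 {k : Type} [Field k] [IsAlgClosed k] [CharZero k]
    {L : Type} [LieRing L] [LieAlgebra k L]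
    {V : Type} [AddCommGroup V] [Module k V] [LieRingModule L V] [LieModule k L V]
    {ιV : Type} [Fintype ιV] [DecidableEq ιV] (bV : Basis ιV k V)
    (H : LieSubalgebra k L) (s : L)
    (hId : ∀ (y x : L), x ∈ H → ⁅y, x⁆ ∈ H)
    (hcodim : finrank k H + 1 = finrank k L)
    (hsum : H.toSubmodule ⊔ Submodule.span k {s} = ⊤)
    (hsV : ∃ B : Basis (Fin (finrank k V)) k V, ∀ i, ∃ μ : k, ⁅s, B i⁆ = μ • B i)
    (hsH : ∃ B : Basis (Fin (finrank k H)) k H,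
      ∀ i, ∃ μ : k, ⁅s, (B i : L)⁆ = μ • (B i : L)) :
    semiCenter bV ((↑) : H → L) = semiCenter bV (id : L → L) := by
  obtain ⟨B, hB⟩ := hsV
  obtain ⟨C, hC⟩ := hsH
  refine le_antisymm (Algebra.adjoin_le ?_) (Algebra.adjoin_mono ?_)
  · rintro f ⟨-, χ, hχ⟩
    obtain ⟨g, hg, rfl⟩ := (Submodule.mem_iSup_iff_exists_finsupp _ f).1
      ((iSup_eigenspace_actDer_eq_top bV B hB).symm ▸ Submodule.mem_top (x := f))
    have hH : ∀ (a : k) (x : H), actDer bV (x : L) (g a) = χ x • g a := by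
      intro a
      let act : H →ₗ[k] MvPolynomial ιV k :=
        { toFun := fun x => actDerLin bV (x : L) (g a)
          map_add' := fun x y => by simp
          map_smul' := fun c x => by simp }
      have hact : act = χ.smulRight (g a) := by
        refine C.ext fun i => ?_
        obtain ⟨μ, hμ⟩ := hC i
        refine apply_component_eq_smul (S := (actDer bV s).toLinearMap)
          (T := (actDer bV (C i : L)).toLinearMap) (μ := μ) (fun m => ?_) hg (hχ (C i)) a
        have h := congrArg (fun D => D m) (actDer_lie bV s (C i : L))
        have hsmul : actDer bV (μ • (C i : L)) = μ • actDer bV (C i : L) :=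
          (actDerLin bV).map_smul _ _
        rw [hμ, hsmul] at h
        simp only [Derivation.commutator_apply, Derivation.smul_apply] at h
        exact (sub_eq_iff_eq_add'.1 h.symm)
      exact fun x => LinearMap.congr_fun hact x
    refine Subalgebra.sum_mem _ fun a ha => Algebra.subset_adjoin ?_
    refine mem_semiInvSet_id_of_forall_exists bV (Finsupp.mem_support_iff.1 ha) fun v => ?_
    obtain ⟨x, hx, y, hy, rfl⟩ := Submodule.mem_sup.1 (hsum.symm ▸ Submodule.mem_top (x := v))
    obtain ⟨c, rfl⟩ := Submodule.mem_span_singleton.1 hy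
    refine ⟨χ ⟨x, hx⟩ + c * a, ?_⟩
    have hadd : actDer bV (x + c • s) = actDer bV x + c • actDer bV s :=
      ((actDerLin bV).map_add _ _).trans (congrArg _ ((actDerLin bV).map_smul _ _))
    have hs : actDer bV s (g a) = a • g a := Module.End.mem_eigenspace_iff.1 (hg a)
    rw [hadd, Derivation.add_apply, Derivation.smul_apply, hs, hH a ⟨x, hx⟩, smul_smul, add_smul]
  · rintro f ⟨hf, χ, hχ⟩
    exact ⟨hf, χ ∘ₗ H.toSubmodule.subtype, fun a => hχ a⟩

end Paper
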